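/- Faà di Bruno formula via shuffles: for smooth functions G : V → U and F : U → S and a multi-index word γ of length n ≥ 1, the partial derivative of the composition satisfies ∂_γ(F∘G)^c(x) = Σ_{m=1}^{n} Σ (1/m!) ∂_{k_1...k_m}F^c(G(x)) ∂_{γ^1}G^{k_1}(x) ··· ∂_{γ^m}G^{k_m}(x), where the inner sum is over all ways to write γ as a shuffle of nonempty words γ^1,...,γ^m (counted with multiplicity of shuffle permutations). -/

import Mathlib

/-- Multiset of all shuffles (interleavings) of two lists. -/
def shuffles {α : Type*} : List α → List α → Multiset (List α)
  | [], bs => {bs}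
  | a :: as, [] => {a :: as}
  | a :: as, b :: bs =>
      (shuffles as (b :: bs)).map (a :: ·) + (shuffles (a :: as) bs).map (b :: ·)
termination_by as bs => as.length + bs.length

/-- Half (ordered) shuffle of two words: the shuffles in which the last letter
of the second word stays last.  Convention: `osh2 a [] = 0`, `osh2 [] b = {b}`. -/
def osh2 {α : Type*} (a b : List α) : Multiset (List α) :=
  match b.getLast? with
  | none => 0
  | some x => (shuffles a b.dropLast).map (· ++ [x])

/-- Multiset of ordered shuffles of a list of words (iterated half-shuffle,
left to right): interleavings in which the final letters of the words appear
in the given relative order. -/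
def oshMany {α : Type*} (ws : List (List α)) : Multiset (List α) :=
  ws.foldl (fun acc w => acc.bind fun u => osh2 u w) {([] : List α)}

/-- Multiset of all shuffles of a list of words. -/
def shMany {α : Type*} (ws : List (List α)) : Multiset (List α) :=
  ws.foldl (fun acc w => acc.bind fun u => shuffles u w) {([] : List α)}

/-- Bounded words: words over `Fin d` of length at most `N`. -/
abbrev BWord (d N : ℕ) := Σ l : Fin (N + 1), Fin (l : ℕ) → Fin d

/-- The word (list) underlying a bounded word. -/
def bwList {d N : ℕ} (g : BWord d N) : List (Fin d) := List.ofFn g.2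

/-- The partial derivative `∂_w f` along the coordinate directions of the
word `w`. -/
noncomputable def pderivWord {d : ℕ} (f : (Fin d → ℝ) → ℝ) {n : ℕ}
    (w : Fin n → Fin d) (x : Fin d → ℝ) : ℝ :=
  iteratedFDeriv ℝ n f x fun i => Pi.single (w i) 1

/-- The tuple of words `g` with the letter `a` prepended to its `i`-th word. -/
def prependAt {α : Type*} {m : ℕ} (a : α) (i : Fin m) (g : Fin m → List α) : Fin m → List α :=
  Function.update g i (a :: g i)

/-- Multiset of all decompositions of a word into an `m`-tuple of complementary, possibly empty
subwords. -/
def unshuffles {α : Type*} (m : ℕ) : List α → Multiset (Fin m → List α)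
  | [] => {fun _ => []}
  | a :: γ => ∑ i, (unshuffles m γ).map (prependAt a i)

/-- Remove the first letter of a word if it is `a`; the result is `none` otherwise. -/
def stripHead {α : Type*} [DecidableEq α] (a : α) : List α → Option (List α)
  | [] => none
  | b :: l => if b = a then some l else none

section Combinatorics

variable {α : Type*}

theorem stripHead_eq_some_iff [DecidableEq α] {a : α} {l t : List α} :
    stripHead a l = some t ↔ l = a :: t := by
  cases l with
  | nil => simp [stripHead]
  | cons b l => by_cases h : b = a <;> simp [stripHead, h]

theorem count_cons_eq_count_filterMap_stripHead [DecidableEq α] (a : α) (γ : List α)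
    (M : Multiset (List α)) :
    M.count (a :: γ) = (M.filterMap (stripHead a)).count γ := by
  induction M using Multiset.induction with
  | empty => simp
  | cons u M ih =>
    rw [Multiset.filterMap_cons, Multiset.count_add, ← ih, Multiset.count_cons, add_comm]
    congr 1
    cases h : stripHead a u with
    | none =>
      have : a :: γ ≠ u := fun h' => by simp [stripHead_eq_some_iff.2 h'.symm] at h
      simp [this]
    | some t => simp [stripHead_eq_some_iff.1 h, Multiset.count_singleton]

theorem filterMap_stripHead_map_cons [DecidableEq α] (a b : α) (M : Multiset (List α)) :
    (M.map (b :: ·)).filterMap (stripHead a) = if b = a then M else 0 := by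
  rw [Multiset.filterMap_map]
  split_ifs with h
  · have : stripHead a ∘ (b :: ·) = some := by ext; simp [stripHead, h]
    rw [this, Multiset.filterMap_some]
  · have : stripHead a ∘ (b :: ·) = fun _ => none := by ext; simp [stripHead, h]
    rw [this]
    induction M using Multiset.induction <;> simp_all

theorem shuffles_nil_right (u : List α) : shuffles u [] = {u} := by
  cases u <;> simp [shuffles]

theorem filterMap_stripHead_shuffles [DecidableEq α] (a : α) (u v : List α) :
    (shuffles u v).filterMap (stripHead a) =
      ((stripHead a u).map (shuffles · v)).getD 0 +
        ((stripHead a v).map (shuffles u ·)).getD 0 := by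
  have h_single (l : List α) : ({l} : Multiset (List α)).filterMap (stripHead a) =
      ((stripHead a l).map singleton).getD 0 := by
    rw [← Multiset.cons_zero, Multiset.filterMap_cons]; simp
  match u, v with
  | [], v => simp [shuffles, stripHead, h_single]
  | b :: u, [] => simp [shuffles_nil_right, stripHead, h_single]
  | b :: u, c :: v =>
    rw [shuffles, Multiset.filterMap_add, filterMap_stripHead_map_cons,
      filterMap_stripHead_map_cons]
    simp only [stripHead]
    split_ifs <;> simp

theorem shMany_ofFn_succ {m : ℕ} (g : Fin (m + 1) → List α) :
    shMany (List.ofFn g) =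
      (shMany (List.ofFn fun i => g i.castSucc)).bind (shuffles · (g (Fin.last m))) := by
  rw [shMany, List.ofFn_succ_last, List.foldl_append]
  rfl

theorem filterMap_stripHead_shMany [DecidableEq α] (a : α) {m : ℕ} (g : Fin m → List α) :
    (shMany (List.ofFn g)).filterMap (stripHead a) =
      ∑ i, ((stripHead a (g i)).map
        fun t => shMany (List.ofFn (Function.update g i t))).getD 0 := by
  induction m with
  | zero =>
    have h : shMany (List.ofFn g) = [] ::ₘ 0 := rfl
    rw [h, Multiset.filterMap_cons]
    simp [stripHead]
  | succ m ih =>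
    rw [Fin.sum_univ_castSucc, shMany_ofFn_succ, Multiset.filterMap_bind]
    simp_rw [filterMap_stripHead_shuffles]
    rw [Multiset.bind_add, ← Multiset.bind_filterMap, ih]
    congr 1
    · have h_add (s : Finset (Fin m)) (f : Fin m → Multiset (List α)) :
          (∑ i ∈ s, f i).bind (shuffles · (g (Fin.last m))) =
            ∑ i ∈ s, (f i).bind (shuffles · (g (Fin.last m))) := by
        induction s using Finset.cons_induction <;> simp_all
      rw [h_add]
      refine Finset.sum_congr rfl fun i _ => ?_
      cases stripHead a (g i.castSucc) with
      | none => simp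
      | some t =>
        have h : (fun j : Fin m => Function.update g i.castSucc t j.castSucc) =
            Function.update (fun j => g j.castSucc) i t := by
          ext1 j
          simp [Function.update_apply]
        simp only [Option.map_some, Option.getD_some]
        rw [shMany_ofFn_succ (Function.update g _ t), h,
          Function.update_of_ne (Fin.castSucc_lt_last i).ne']
    · cases stripHead a (g (Fin.last m)) with
      | none => simp
      | some t =>
        have h : (fun j : Fin m => Function.update g (Fin.last m) t j.castSucc) =
            fun j => g j.castSucc := by
          ext1 j
          simp [(Fin.castSucc_lt_last j).ne]
        simp only [Option.map_some, Option.getD_some]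
        rw [shMany_ofFn_succ (Function.update g _ t), h, Function.update_self]

theorem count_nil_shuffles [DecidableEq α] (u v : List α) :
    (shuffles u v).count [] = if u = [] ∧ v = [] then 1 else 0 := by
  match u, v with
  | [], v => simp [shuffles, Multiset.count_singleton, eq_comm]
  | b :: u, [] => simp [shuffles]
  | b :: u, c :: v => simp [shuffles]

theorem count_nil_shMany [DecidableEq α] {m : ℕ} (g : Fin m → List α) :
    (shMany (List.ofFn g)).count [] = if g = fun _ => [] then 1 else 0 := by
  induction m with
  | zero => simp [shMany, funext_iff]
  | succ m ih =>
    have h_sum (M : Multiset (List α)) (p : Prop) [Decidable p] :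
        (M.map fun u => if u = [] ∧ p then 1 else 0).sum = if p then M.count [] else 0 := by
      induction M using Multiset.induction with
      | empty => simp
      | cons u M ih =>
        rw [Multiset.map_cons, Multiset.sum_cons, ih, Multiset.count_cons]
        by_cases hu : u = [] <;> by_cases hp : p <;> simp [hu, hp, eq_comm, add_comm]
    rw [shMany_ofFn_succ, Multiset.count_bind]
    simp_rw [count_nil_shuffles]
    rw [h_sum, ih]
    simp only [funext_iff, Fin.forall_fin_succ']
    split_ifs <;> tauto

theorem count_map_prependAt [DecidableEq α] {m : ℕ} (a : α) (i : Fin m) (g : Fin m → List α)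
    (M : Multiset (Fin m → List α)) :
    (M.map (prependAt a i)).count g =
      ((stripHead a (g i)).map fun t => M.count (Function.update g i t)).getD 0 := by
  cases h : stripHead a (g i) with
  | none =>
    simp only [Option.map_none, Option.getD_none, Multiset.count_eq_zero, Multiset.mem_map,
      not_exists, not_and]
    rintro g' - rfl
    simp [prependAt, stripHead] at h
  | some t =>
    rw [stripHead_eq_some_iff] at h
    have h_inj : Function.Injective (prependAt a i) := by
      intro g₁ g₂ h₁₂
      ext1 j
      have hj := congrFun h₁₂ j
      by_cases hji : j = i
      · subst hji; simpa [prependAt] using hj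
      · simpa [prependAt, hji] using hj
    have hg : prependAt a i (Function.update g i t) = g := by
      simp [prependAt, ← h]
    conv_lhs => rw [← hg]
    rw [Multiset.count_map_eq_count' _ _ h_inj]
    simp

theorem count_unshuffles [DecidableEq α] {m : ℕ} (γ : List α) (g : Fin m → List α) :
    (unshuffles m γ).count g = (shMany (List.ofFn g)).count γ := by
  induction γ generalizing g with
  | nil => simp [unshuffles, count_nil_shMany, Multiset.count_singleton]
  | cons a γ ih =>
    rw [count_cons_eq_count_filterMap_stripHead, filterMap_stripHead_shMany, unshuffles,
      Multiset.count_sum', Multiset.count_sum']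
    refine Finset.sum_congr rfl fun i _ => ?_
    rw [count_map_prependAt]
    cases stripHead a (g i) <;> simp [ih]

theorem sum_length_of_mem_unshuffles {m : ℕ} {γ : List α} {g : Fin m → List α}
    (hg : g ∈ unshuffles m γ) : ∑ i, (g i).length = γ.length := by
  induction γ generalizing g with
  | nil =>
    obtain rfl : g = fun _ => [] := by simpa [unshuffles] using hg
    simp
  | cons a γ ih =>
    simp only [unshuffles, Multiset.mem_sum, Finset.mem_univ, true_and, Multiset.mem_map] at hg
    obtain ⟨i, g, hg, rfl⟩ := hg
    have h_len (j : Fin m) : (prependAt a i g j).length =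
        (g j).length + if j = i then 1 else 0 := by
      by_cases hji : j = i
      · subst hji; simp [prependAt]
      · simp [prependAt, hji]
    simp [h_len, Finset.sum_add_distrib, ih hg]

theorem filter_unshuffles_eq_nil {m : ℕ} (γ : List α) (i : Fin (m + 1))
    [DecidablePred fun g : Fin (m + 1) → List α => g i = []] :
    (unshuffles (m + 1) γ).filter (fun g => g i = []) =
      (unshuffles m γ).map (i.insertNth (α := fun _ => List α) []) := by
  induction γ with
  | nil =>
    simp only [unshuffles, Multiset.map_singleton]
    rw [Multiset.filter_eq_self.2 (by simp)]
    congr 1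
    exact (Fin.insertNth_eq_iff.2 ⟨rfl, rfl⟩).symm
  | cons a γ ih =>
    have h_filter (s : Finset (Fin (m + 1))) (f : Fin (m + 1) → Multiset (Fin (m + 1) → List α)) :
        (∑ j ∈ s, f j).filter (fun g => g i = []) =
          ∑ j ∈ s, (f j).filter (fun g => g i = []) := by
      induction s using Finset.cons_induction <;> simp_all
    have h_map (s : Finset (Fin m)) (f : Fin m → Multiset (Fin m → List α)) :
        (∑ j ∈ s, f j).map (i.insertNth (α := fun _ => List α) []) =
          ∑ j ∈ s, (f j).map (i.insertNth (α := fun _ => List α) []) := by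
      induction s using Finset.cons_induction <;> simp_all
    rw [unshuffles, unshuffles, h_filter, h_map, Fin.sum_univ_succAbove _ i]
    rw [Multiset.filter_eq_nil.2 (by simp [prependAt]), zero_add]
    refine Finset.sum_congr rfl fun j _ => ?_
    rw [Multiset.filter_map]
    have h_comp : ((fun g : Fin (m + 1) → List α => g i = []) ∘ prependAt a (i.succAbove j)) =
        fun g => g i = [] := by
      ext g
      simp [prependAt]
    simp only [h_comp]
    rw [ih, Multiset.map_map, Multiset.map_map]
    refine Multiset.map_congr rfl fun g _ => ?_
    simp [prependAt, Fin.insertNth_update]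

end Combinatorics

/-- The iterated partial derivative of `f` along the letters of a word, the first letter being the
outermost derivative. -/
noncomputable def wordDeriv {d : ℕ} {E : Type*} [NormedAddCommGroup E] [NormedSpace ℝ E]
    (f : (Fin d → ℝ) → E) : List (Fin d) → (Fin d → ℝ) → E
  | [] => f
  | a :: w => fun x => fderiv ℝ (wordDeriv f w) x (Pi.single a 1)

section Calculus

variable {E F : Type*} [NormedAddCommGroup E] [NormedSpace ℝ E] [NormedAddCommGroup F]
  [NormedSpace ℝ F]

theorem ContDiff.wordDeriv {d : ℕ} {f : (Fin d → ℝ) → E} (hf : ContDiff ℝ (⊤ : ℕ∞) f)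
    (w : List (Fin d)) : ContDiff ℝ (⊤ : ℕ∞) (wordDeriv f w) := by
  induction w with
  | nil => exact hf
  | cons a w ih => exact (ih.fderiv_right (m := (⊤ : ℕ∞)) le_rfl).clm_apply contDiff_const

theorem ContDiff.contDiff_iteratedFDeriv {f : E → F} (hf : ContDiff ℝ (⊤ : ℕ∞) f) (n : ℕ) :
    ContDiff ℝ (⊤ : ℕ∞) (iteratedFDeriv ℝ n f) :=
  hf.iteratedFDeriv_right (by exact_mod_cast le_top)

theorem ContDiff.differentiable_iteratedFDeriv_top {f : E → F} (hf : ContDiff ℝ (⊤ : ℕ∞) f)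
    (n : ℕ) : Differentiable ℝ (iteratedFDeriv ℝ n f) :=
  (hf.contDiff_iteratedFDeriv n).differentiable (by simp)

theorem ContDiff.iteratedFDeriv_cons {f : E → F} (hf : ContDiff ℝ (⊤ : ℕ∞) f) {n : ℕ} (v : E)
    (u : Fin n → E) (x : E) :
    iteratedFDeriv ℝ (n + 1) f x (Fin.cons v u) =
      fderiv ℝ (fun y => iteratedFDeriv ℝ n f y u) x v := by
  rw [iteratedFDeriv_succ_apply_left,
    ((hf.differentiable_iteratedFDeriv_top n x).hasFDerivAt.continuousMultilinear_apply_const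
      u).fderiv]
  simp

theorem ContDiff.iteratedFDeriv_cons_comm {f : E → F} (hf : ContDiff ℝ (⊤ : ℕ∞) f) {n : ℕ}
    (v w : E) (u : Fin n → E) (x : E) :
    iteratedFDeriv ℝ (n + 2) f x (Fin.cons v (Fin.cons w u : Fin (n + 1) → E)) =
      iteratedFDeriv ℝ (n + 2) f x (Fin.cons w (Fin.cons v u : Fin (n + 1) → E)) := by
  have h_smooth : ContDiff ℝ (⊤ : ℕ∞) fun y => iteratedFDeriv ℝ n f y u :=
    (ContinuousMultilinearMap.apply ℝ (fun _ : Fin n => E) F u).contDiff.comp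
      (hf.contDiff_iteratedFDeriv n)
  have h_diff : Differentiable ℝ (fderiv ℝ fun y => iteratedFDeriv ℝ n f y u) :=
    (h_smooth.fderiv_right (m := (⊤ : ℕ∞)) le_rfl).differentiable (by simp)
  have h_symm := (h_smooth.contDiffAt (x := x)).isSymmSndFDerivAt
    (by simpa using WithTop.coe_le_coe.2 (le_top : (2 : ℕ∞) ≤ ⊤))
  have h_snd (a b : E) :
      iteratedFDeriv ℝ (n + 2) f x (Fin.cons a (Fin.cons b u : Fin (n + 1) → E)) =
        fderiv ℝ (fderiv ℝ fun y => iteratedFDeriv ℝ n f y u) x a b := by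
    rw [hf.iteratedFDeriv_cons]
    simp_rw [hf.iteratedFDeriv_cons]
    rw [fderiv_clm_apply (h_diff x) (differentiableAt_const b)]
    simp
  rw [h_snd, h_snd, h_symm.eq]

theorem ContDiff.iteratedFDeriv_insertNth {f : E → F} (hf : ContDiff ℝ (⊤ : ℕ∞) f) {n : ℕ}
    (i : Fin (n + 1)) (v : E) (u : Fin n → E) (x : E) :
    iteratedFDeriv ℝ (n + 1) f x (i.insertNth (α := fun _ => E) v u) =
      iteratedFDeriv ℝ (n + 1) f x (Fin.cons v u) := by
  induction n generalizing x with
  | zero => rw [Fin.fin_one_eq_zero i, Fin.insertNth_zero']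
  | succ n ih =>
    cases i using Fin.cases with
    | zero => rw [Fin.insertNth_zero']
    | succ j =>
      have h_cons : j.succ.insertNth (α := fun _ => E) v u =
          Fin.cons (u 0) (j.insertNth (α := fun _ => E) v (Fin.tail u)) := by
        rw [Fin.insertNth_eq_iff]
        refine ⟨by simp, ?_⟩
        ext1 k
        cases k using Fin.cases <;> simp [Fin.removeNth, Fin.tail]
      rw [h_cons, hf.iteratedFDeriv_cons]
      simp_rw [ih j (Fin.tail u)]
      rw [← hf.iteratedFDeriv_cons, hf.iteratedFDeriv_cons_comm, Fin.cons_self_tail]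

theorem ContDiff.iteratedFDeriv_single_eq_wordDeriv {d : ℕ} {f : (Fin d → ℝ) → E}
    (hf : ContDiff ℝ (⊤ : ℕ∞) f) {n : ℕ} (w : Fin n → Fin d) (x : Fin d → ℝ) :
    iteratedFDeriv ℝ n f x (fun i => Pi.single (w i) 1) = _root_.wordDeriv f (List.ofFn w) x := by
  induction n generalizing x with
  | zero => simp [_root_.wordDeriv]
  | succ n ih =>
    have h_cons : (fun i => Pi.single (w i) 1 : Fin (n + 1) → Fin d → ℝ) =
        Fin.cons (Pi.single (w 0) 1) fun i => Pi.single (w i.succ) 1 := by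
      ext1 i
      cases i using Fin.cases <;> simp
    rw [h_cons, hf.iteratedFDeriv_cons, List.ofFn_succ]
    simp_rw [ih]
    rfl

theorem ContDiff.wordDeriv_apply {d e : ℕ} {G : (Fin d → ℝ) → Fin e → ℝ}
    (hG : ContDiff ℝ (⊤ : ℕ∞) G) (k : Fin e) (w : List (Fin d)) (x : Fin d → ℝ) :
    _root_.wordDeriv (fun y => G y k) w x = _root_.wordDeriv G w x k := by
  induction w generalizing x with
  | nil => rfl
  | cons a w ih =>
    have h_fun : _root_.wordDeriv (fun y => G y k) w =
        fun y => _root_.wordDeriv G w y k := funext ih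
    have h_diff : DifferentiableAt ℝ (_root_.wordDeriv G w) x :=
      (hG.wordDeriv w).differentiable (by simp) x
    simp only [_root_.wordDeriv, h_fun]
    rw [(hasFDerivAt_pi'.1 h_diff.hasFDerivAt k).fderiv]
    rfl

/-- The derivative of `f` of order `m` at `G x`, evaluated at the partial derivatives of `G` along
the words of the tuple `g`. -/
noncomputable def faaTerm {d e : ℕ} (f : (Fin e → ℝ) → E) (G : (Fin d → ℝ) → Fin e → ℝ) {m : ℕ}
    (g : Fin m → List (Fin d)) (x : Fin d → ℝ) : E :=
  iteratedFDeriv ℝ m f (G x) fun i => wordDeriv G (g i) x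

variable {d e : ℕ} {f : (Fin e → ℝ) → E} {G : (Fin d → ℝ) → Fin e → ℝ}

theorem hasFDerivAt_faaTerm (hf : ContDiff ℝ (⊤ : ℕ∞) f) (hG : ContDiff ℝ (⊤ : ℕ∞) G) {m : ℕ}
    (g : Fin m → List (Fin d)) (x : Fin d → ℝ) :
    HasFDerivAt (faaTerm f G g)
      (ContinuousMultilinearMap.apply ℝ (fun _ : Fin m => Fin e → ℝ) E
          (fun i => wordDeriv G (g i) x) ∘L
            (fderiv ℝ (iteratedFDeriv ℝ m f) (G x) ∘L fderiv ℝ G x) +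
        ∑ i, (iteratedFDeriv ℝ m f (G x)).toContinuousLinearMap (fun i => wordDeriv G (g i) x) i ∘L
          fderiv ℝ (wordDeriv G (g i)) x) x :=
  ((hf.differentiable_iteratedFDeriv_top m (G x)).hasFDerivAt.comp x
    (hG.differentiable (by simp) x).hasFDerivAt).continuousMultilinearMap_apply
      fun i => ((hG.wordDeriv (g i)).differentiable (by simp) x).hasFDerivAt

theorem fderiv_faaTerm_single (hf : ContDiff ℝ (⊤ : ℕ∞) f) (hG : ContDiff ℝ (⊤ : ℕ∞) G) {m : ℕ}
    (g : Fin m → List (Fin d)) (x : Fin d → ℝ) (a : Fin d) :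
    fderiv ℝ (faaTerm f G g) x (Pi.single a 1) =
      faaTerm f G (Fin.cons [a] g : Fin (m + 1) → List (Fin d)) x +
        ∑ i, faaTerm f G (prependAt a i g) x := by
  rw [(hasFDerivAt_faaTerm hf hG g x).fderiv, add_apply, sum_apply]
  refine congrArg₂ (· + ·) ?_ (Finset.sum_congr rfl fun i _ => ?_)
  · rw [faaTerm, iteratedFDeriv_succ_apply_left]
    rfl
  · simp only [ContinuousLinearMap.comp_apply, faaTerm]
    simp only [ContinuousMultilinearMap.toContinuousLinearMap_apply]
    congr 1
    ext1 j
    by_cases hji : j = i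
    · subst hji; simp [prependAt, wordDeriv]
    · simp [prependAt, hji]

theorem faaTerm_insertNth (hf : ContDiff ℝ (⊤ : ℕ∞) f) {m : ℕ} (i : Fin (m + 1))
    (w : List (Fin d)) (g : Fin m → List (Fin d)) (x : Fin d → ℝ) :
    faaTerm f G (i.insertNth (α := fun _ => List (Fin d)) w g) x =
      faaTerm f G (Fin.cons w g : Fin (m + 1) → List (Fin d)) x := by
  have h_ins : (fun j => wordDeriv G (i.insertNth (α := fun _ => List (Fin d)) w g j) x) =
      i.insertNth (α := fun _ => Fin e → ℝ) (wordDeriv G w x) fun j => wordDeriv G (g j) x := by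
    rw [Fin.eq_insertNth_iff]
    refine ⟨by simp, ?_⟩
    ext1 j
    simp [Fin.removeNth]
  have h_cons : (fun j => wordDeriv G ((Fin.cons w g : Fin (m + 1) → List (Fin d)) j) x) =
      Fin.cons (wordDeriv G w x) fun j => wordDeriv G (g j) x := by
    ext1 j
    cases j using Fin.cases <;> simp
  rw [faaTerm, faaTerm, h_ins, h_cons, hf.iteratedFDeriv_insertNth]

end Calculus

theorem Multiset.sum_map_ite_eq_sum_map_filter {β E : Type*} [AddCommMonoid E] (p : β → Prop)
    [DecidablePred p] (φ : β → E) (M : Multiset β) :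
    (M.map fun g => if p g then φ g else 0).sum = ((M.filter p).map φ).sum := by
  induction M using Multiset.induction with
  | empty => simp
  | cons g M ih => by_cases h : p g <;> simp [h, ih]

theorem sum_map_prependAt_unshuffles {α E : Type*} [AddCommMonoid E] {m : ℕ} (γ : List α) (a : α)
    (i : Fin (m + 1)) (φ : (Fin (m + 1) → List α) → E) :
    ((unshuffles (m + 1) γ).map fun g =>
        if ∀ j, prependAt a i g j ≠ [] then φ (prependAt a i g) else 0).sum =
      ((unshuffles (m + 1) γ).map fun g => if ∀ j, g j ≠ [] then φ (prependAt a i g) else 0).sum +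
        ((unshuffles m γ).map fun g =>
          if ∀ j, g j ≠ [] then φ (i.insertNth (α := fun _ => List α) [a] g) else 0).sum := by
  have h_split (g : Fin (m + 1) → List α) :
      (if ∀ j, prependAt a i g j ≠ [] then φ (prependAt a i g) else 0) =
        (if ∀ j, g j ≠ [] then φ (prependAt a i g) else 0) +
          if g i = [] then
            (if ∀ j, g (i.succAbove j) ≠ [] then φ (prependAt a i g) else 0) else 0 := by
    have h_iff : (∀ j, prependAt a i g j ≠ []) ↔ ∀ j, g (i.succAbove j) ≠ [] := by
      simp [Fin.forall_iff_succAbove i, prependAt]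
    simp only [h_iff, Fin.forall_iff_succAbove i (P := fun j => g j ≠ [])]
    by_cases h₁ : g i = [] <;> by_cases h₂ : ∀ j, g (i.succAbove j) ≠ [] <;> simp [h₁, h₂]
  simp_rw [h_split]
  rw [Multiset.sum_map_add, Multiset.sum_map_ite_eq_sum_map_filter
    (fun g : Fin (m + 1) → List α => g i = []),
    filter_unshuffles_eq_nil, Multiset.map_map]
  simp [Function.comp_def, prependAt, Fin.update_insertNth]

section FaaDiBruno

variable {E F : Type*} [NormedAddCommGroup E] [NormedSpace ℝ E] [NormedAddCommGroup F]
  [NormedSpace ℝ F]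

theorem hasFDerivAt_multiset_sum_map {β : Type*} {T : β → E → F} {T' : β → E →L[ℝ] F} {x : E}
    (hT : ∀ g, HasFDerivAt (T g) (T' g) x) (M : Multiset β) :
    HasFDerivAt (fun y => (M.map fun g => T g y).sum) (M.map T').sum x := by
  induction M using Multiset.induction with
  | empty => simpa using hasFDerivAt_const (0 : F) x
  | cons g M ih => simpa using (hT g).fun_add ih

/-- Faà di Bruno formula for the partial derivative of a composition along a word, as a sum over
the decompositions of the word into nonempty complementary subwords. -/
theorem wordDeriv_comp {d e : ℕ} {f : (Fin e → ℝ) → E} {G : (Fin d → ℝ) → Fin e → ℝ}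
    (hf : ContDiff ℝ (⊤ : ℕ∞) f) (hG : ContDiff ℝ (⊤ : ℕ∞) G) (γ : List (Fin d))
    (x : Fin d → ℝ) :
    wordDeriv (fun y => f (G y)) γ x =
      ∑ m ∈ Finset.range (γ.length + 1), (m.factorial : ℝ)⁻¹ •
        ((unshuffles m γ).map fun g => if ∀ i, g i ≠ [] then faaTerm f G g x else 0).sum := by
  induction γ generalizing x with
  | nil => simp [wordDeriv, unshuffles, faaTerm]
  | cons a γ ih =>
    let X (m : ℕ) : E := ((unshuffles m γ).map fun g =>
      if ∀ i, g i ≠ [] then ∑ i, faaTerm f G (prependAt a i g) x else 0).sum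
    let Y (m : ℕ) : E := ((unshuffles m γ).map fun g =>
      if ∀ i, g i ≠ [] then faaTerm f G (Fin.cons [a] g : Fin (m + 1) → List (Fin d)) x else 0).sum
    have h_left : wordDeriv (fun y => f (G y)) (a :: γ) x =
        ∑ m ∈ Finset.range (γ.length + 1), (m.factorial : ℝ)⁻¹ • (X m + Y m) := by
      have h_deriv (m : ℕ) := hasFDerivAt_multiset_sum_map (x := x)
        (T := fun (g : Fin m → List (Fin d)) y => if ∀ i, g i ≠ [] then faaTerm f G g y else 0)
        (T' := fun g => if ∀ i, g i ≠ [] then fderiv ℝ (faaTerm f G g) x else 0)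
        (fun g => by
          by_cases h : ∀ i, g i ≠ []
          · simp only [if_pos h]
            exact (hasFDerivAt_faaTerm hf hG g x).differentiableAt.hasFDerivAt
          · simp only [if_neg h]
            exact hasFDerivAt_const (0 : E) x) (unshuffles m γ)
      simp only [wordDeriv, funext ih]
      rw [(HasFDerivAt.fun_sum fun m _ => (h_deriv m).fun_const_smul (m.factorial : ℝ)⁻¹).fderiv,
        sum_apply]
      refine Finset.sum_congr rfl fun m _ => ?_
      rw [smul_apply, ← ContinuousLinearMap.apply_apply (𝕜 := ℝ) (Pi.single a 1) (Multiset.sum _),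
        map_multiset_sum, Multiset.map_map, ← Multiset.sum_map_add]
      congr 2
      refine Multiset.map_congr rfl fun g _ => ?_
      by_cases h : ∀ i, g i ≠ []
      · simp only [Function.comp_apply, if_pos h, ContinuousLinearMap.apply_apply,
          fderiv_faaTerm_single hf hG, add_comm]
      · simp only [Function.comp_apply, if_neg h, map_zero, add_zero]
    have h_right (m : ℕ) : ((unshuffles m (a :: γ)).map fun g =>
        if ∀ i, g i ≠ [] then faaTerm f G g x else 0).sum =
          ∑ i, ((unshuffles m γ).map fun g => if ∀ j, prependAt a i g j ≠ [] then
            faaTerm f G (prependAt a i g) x else 0).sum := by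
      have h_map (s : Finset (Fin m)) (M : Fin m → Multiset (Fin m → List (Fin d)))
          (φ : (Fin m → List (Fin d)) → E) :
          ((∑ i ∈ s, M i).map φ).sum = ∑ i ∈ s, ((M i).map φ).sum := by
        induction s using Finset.cons_induction <;> simp_all
      rw [unshuffles, h_map]
      simp [Multiset.map_map]
    have h_X (m : ℕ) : X m = ∑ i, ((unshuffles m γ).map fun g =>
        if ∀ j, g j ≠ [] then faaTerm f G (prependAt a i g) x else 0).sum := by
      have h_swap (M : Multiset (Fin m → List (Fin d))) (φ : Fin m → (Fin m → List (Fin d)) → E) :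
          ∑ i, (M.map (φ i)).sum = (M.map fun g => ∑ i, φ i g).sum := by
        induction M using Multiset.induction <;> simp_all [Finset.sum_add_distrib]
      rw [h_swap]
      refine congrArg Multiset.sum (Multiset.map_congr rfl fun g _ => ?_)
      by_cases h : ∀ i, g i ≠ []
      · simp only [if_pos h]
      · simp only [if_neg h, Finset.sum_const_zero]
    have h_zero : X (γ.length + 1) = 0 := by
      refine Multiset.sum_eq_zero fun y hy => ?_
      obtain ⟨g, hg, rfl⟩ := Multiset.mem_map.1 hy
      refine if_neg fun h => ?_
      have h_le : ∑ _i : Fin (γ.length + 1), 1 ≤ ∑ i, (g i).length :=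
        Finset.sum_le_sum fun i _ => List.length_pos_iff.2 (h i)
      rw [sum_length_of_mem_unshuffles hg] at h_le
      simp at h_le
    have h_succ (m : ℕ) : ((unshuffles (m + 1) (a :: γ)).map fun g =>
        if ∀ i, g i ≠ [] then faaTerm f G g x else 0).sum =
          X (m + 1) + ((m + 1 : ℕ) : ℝ) • Y m := by
      rw [h_right, h_X, Finset.sum_congr rfl fun i _ =>
        sum_map_prependAt_unshuffles γ a i fun g => faaTerm f G g x]
      simp_rw [faaTerm_insertNth hf]
      rw [Finset.sum_add_distrib, Finset.sum_const, Finset.card_univ, Fintype.card_fin,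
        Nat.cast_smul_eq_nsmul]
    rw [h_left, List.length_cons, Finset.sum_range_succ' _ (γ.length + 1)]
    simp_rw [h_succ, smul_add]
    rw [Finset.sum_add_distrib, Finset.sum_add_distrib, add_right_comm]
    congr 1
    · have h₀ : X 0 = ((unshuffles 0 (a :: γ)).map fun g =>
          if ∀ i, g i ≠ [] then faaTerm f G g x else 0).sum := by rw [h_right, h_X]; simp
      rw [← h₀, ← Finset.sum_range_succ' (fun m => (m.factorial : ℝ)⁻¹ • X m),
        Finset.sum_range_succ _ (γ.length + 1), h_zero, smul_zero, add_zero]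
    · refine Finset.sum_congr rfl fun m _ => ?_
      rw [smul_smul, Nat.factorial_succ]
      congr 1
      push_cast
      field_simp

end FaaDiBruno

theorem iteratedFDeriv_apply_eq_sum_single {e : ℕ} (f : (Fin e → ℝ) → ℝ) {m : ℕ} (z : Fin e → ℝ)
    (v : Fin m → Fin e → ℝ) :
    iteratedFDeriv ℝ m f z v =
      ∑ k : Fin m → Fin e,
        iteratedFDeriv ℝ m f z (fun i => Pi.single (k i) 1) * ∏ i, v i (k i) := by
  have h_v : v = fun i => ∑ k, v i k • (Pi.single k 1 : Fin e → ℝ) :=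
    funext fun i => pi_eq_sum_univ' (v i)
  conv_lhs => rw [h_v]
  rw [ContinuousMultilinearMap.map_sum]
  refine Finset.sum_congr rfl fun k _ => ?_
  rw [ContinuousMultilinearMap.map_smul_univ, smul_eq_mul, mul_comm]

theorem bwList_injective {d N : ℕ} : Function.Injective (bwList : BWord d N → List (Fin d)) := by
  rintro ⟨⟨l, hl⟩, u⟩ ⟨⟨l', hl'⟩, u'⟩ h
  obtain rfl : l = l' := by simpa [bwList] using congrArg List.length h
  simpa [bwList] using List.ofFn_injective h

theorem exists_bwList_eq {d N : ℕ} {l : List (Fin d)} (hl : l.length ≤ N) :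
    ∃ g : BWord d N, bwList g = l :=
  ⟨⟨⟨l.length, Nat.lt_succ_of_le hl⟩, l.get⟩, by simp [bwList]⟩

theorem sum_map_unshuffles_eq_sum_bwList {d N m : ℕ} (γ : List (Fin d)) (hγ : γ.length ≤ N)
    (φ : (Fin m → List (Fin d)) → ℝ) :
    ((unshuffles m γ).map φ).sum =
      ∑ g : Fin m → BWord d N,
        ((shMany (List.ofFn fun i => bwList (g i))).count γ : ℝ) * φ fun i => bwList (g i) := by
  rw [Finset.sum_multiset_map_count]
  have h_inj : Function.Injective fun (g : Fin m → BWord d N) i => bwList (g i) :=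
    fun g g' h => funext fun i => bwList_injective (congrFun h i)
  refine Eq.trans ?_ (Finset.sum_map Finset.univ ⟨_, h_inj⟩
    fun g : Fin m → List (Fin d) => ((shMany (List.ofFn g)).count γ : ℝ) * φ g)
  simp_rw [← count_unshuffles, nsmul_eq_mul]
  refine Finset.sum_subset (fun g hg => ?_) fun g _ hg => ?_
  · rw [Multiset.mem_toFinset] at hg
    have h_len (i : Fin m) : (g i).length ≤ N :=
      (Finset.single_le_sum (f := fun i => (g i).length) (fun _ _ => Nat.zero_le _)
        (Finset.mem_univ i)).trans ((sum_length_of_mem_unshuffles hg).trans_le hγ)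
    choose b hb using fun i => exists_bwList_eq (h_len i)
    exact Finset.mem_map.2 ⟨b, Finset.mem_univ _, funext hb⟩
  · rw [Multiset.mem_toFinset] at hg
    simp [Multiset.count_eq_zero_of_notMem hg]

/-- **Faà di Bruno via shuffles.** For smooth `G : V → U`,
`F : U → S` and a word `γ` of length `n ≥ 1`,
`∂_γ(F∘G)^c(x) = Σ_{m=1}^n Σ_{(γ¹,…,γᵐ) ∈ Sh⁻¹(γ), γⁱ ≠ ∅} (1/m!)
∂_{k₁…k_m}F^c(G(x)) ∂_{γ¹}G^{k₁}(x) ⋯ ∂_{γᵐ}G^{k_m}(x)`, the decompositions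
counted with the multiplicity of the shuffle permutations. -/
theorem faa_di_bruno_shuffles (dV dU dS : ℕ)
    (G : (Fin dV → ℝ) → Fin dU → ℝ) (F : (Fin dU → ℝ) → Fin dS → ℝ)
    (hG : ContDiff ℝ (⊤ : ℕ∞) G) (hF : ContDiff ℝ (⊤ : ℕ∞) F)
    (n : ℕ) (hn : 1 ≤ n) (γ : Fin n → Fin dV) (c : Fin dS) (x : Fin dV → ℝ) :
    pderivWord (fun y => F (G y) c) γ x =
      ∑ m ∈ Finset.Icc 1 n, ∑ g : Fin m → BWord dV n,
        if ∀ i, 1 ≤ ((g i).1 : ℕ) then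
          ((shMany (List.ofFn fun i => bwList (g i))).count (List.ofFn γ) : ℝ) *
            (1 / (m.factorial : ℝ)) *
              ∑ k : Fin m → Fin dU,
                iteratedFDeriv ℝ m (fun y => F y c) (G x) (fun i => Pi.single (k i) 1) *
                  ∏ i, pderivWord (fun y => G y (k i)) ((g i).2) x
        else 0 := by
  have hf : ContDiff ℝ (⊤ : ℕ∞) fun y => F y c := contDiff_pi.1 hF c
  have hfG : ContDiff ℝ (⊤ : ℕ∞) fun y => F (G y) c := hf.comp hG
  rw [pderivWord, hfG.iteratedFDeriv_single_eq_wordDeriv, wordDeriv_comp hf hG, List.length_ofFn]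
  have h_zero : unshuffles 0 (List.ofFn γ) = 0 := by
    obtain ⟨n, rfl⟩ := Nat.exists_eq_add_of_le' hn
    simp [List.ofFn_succ, unshuffles]
  have h_sub : Finset.Icc 1 n ⊆ Finset.range (n + 1) := fun m hm => by
    rw [Finset.mem_Icc] at hm
    exact Finset.mem_range.2 (by omega)
  rw [← Finset.sum_subset h_sub fun m hm hm' => ?_]
  swap
  · obtain rfl : m = 0 := by
      rw [Finset.mem_Icc] at hm'
      rw [Finset.mem_range] at hm
      omega
    simp [h_zero]
  refine Finset.sum_congr rfl fun m _ => ?_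
  rw [sum_map_unshuffles_eq_sum_bwList (N := n) _ (by simp), Finset.smul_sum]
  refine Finset.sum_congr rfl fun g _ => ?_
  have h_iff : (∀ i, bwList (g i) ≠ []) ↔ ∀ i, 1 ≤ ((g i).1 : ℕ) := by
    simp [bwList, List.ofFn_eq_nil_iff, Nat.one_le_iff_ne_zero]
  simp only [h_iff]
  split_ifs
  · rw [faaTerm, iteratedFDeriv_apply_eq_sum_single, smul_eq_mul, one_div, mul_left_comm,
      ← mul_assoc]
    congr 1
    refine Finset.sum_congr rfl fun k _ => ?_
    congr 1
    refine Finset.prod_congr rfl fun i _ => ?_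
    have hGk : ContDiff ℝ (⊤ : ℕ∞) fun y => G y (k i) := contDiff_pi.1 hG (k i)
    rw [pderivWord, hGk.iteratedFDeriv_single_eq_wordDeriv, hG.wordDeriv_apply]
    rfl
  · simp
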